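/- arXiv:1906.06259 — 2 statements merged into one kernel-verified Lean document; each statement's English description precedes it below -/
import Mathlib

section
/- Let I be a square-free monomial ideal of R = k[x_1,...,x_n] (k a field) with associated Stanley–Reisner simplicial complex Δ = Δ(I). Suppose reg(I) ≤ r and pd(I) ≤ n - r. If the reduced Euler characteristic satisfies χ̃(Δ) ≠ 0, then reg(I) = r. -/
/-- The faces of cardinality `m` of a simplicial complex, given as a finite
family of finite subsets of `Fin n`. -/
def cfaces {n : ℕ} (Δ : Finset (Finset (Fin n))) (m : ℕ) : Finset (Finset (Fin n)) :=
  Δ.filter (fun F => F.card = m)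

/-- The coefficient of the face `G` in the simplicial boundary of the face `F`
(with respect to the linear order on the vertices `Fin n`). -/
noncomputable def bcoeff (K : Type*) [Field K] {n : ℕ} (F G : Finset (Fin n)) : K :=
  ∑ v ∈ F, if F.erase v = G then (-1 : K) ^ (F.filter (fun w => w < v)).card else 0

/-- The simplicial boundary map from chains spanned by faces of cardinality `m+1`
to chains spanned by faces of cardinality `m` (so the augmentation map
corresponds to `m = 0`). -/
noncomputable def boundaryMap (K : Type*) [Field K] {n : ℕ}
    (Δ : Finset (Finset (Fin n))) (m : ℕ) :
    ({F // F ∈ cfaces Δ (m + 1)} → K) →ₗ[K] ({G // G ∈ cfaces Δ m} → K) :=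
  LinearMap.pi fun G => ∑ F : {F // F ∈ cfaces Δ (m + 1)}, bcoeff K F.1 G.1 • LinearMap.proj F

/-- The dimension over `K` of the `i`-th reduced simplicial homology of the
simplicial complex `Δ` (using the augmented chain complex, so that
`i = -1` is allowed). -/
noncomputable def reducedHomologyRank (K : Type*) [Field K] {n : ℕ}
    (Δ : Finset (Finset (Fin n))) (i : ℤ) : ℕ :=
  if i = -1 then
    Module.finrank K (({F // F ∈ cfaces Δ 0} → K) ⧸ LinearMap.range (boundaryMap K Δ 0))
  else if 0 ≤ i then
    Module.finrank K
      (↥(LinearMap.ker (boundaryMap K Δ i.toNat)) ⧸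
        Submodule.comap (LinearMap.ker (boundaryMap K Δ i.toNat)).subtype
          (LinearMap.range (boundaryMap K Δ (i.toNat + 1))))
  else 0

/-- The graded Betti numbers `β_{i,j}` of the Stanley–Reisner ideal of the
simplicial complex `Δ` over the field `K`, defined via Hochster's formula:
`β_{i,j} = ∑_{|W| = j} dim_K H̃_{j-i-2}(Δ_W; K)`. -/
noncomputable def bettiNumber (K : Type*) [Field K] {n : ℕ}
    (Δ : Finset (Finset (Fin n))) (i j : ℕ) : ℕ :=
  ∑ W ∈ Finset.powersetCard j (Finset.univ : Finset (Fin n)),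
    reducedHomologyRank K (Δ.filter (fun F => F ⊆ W)) ((j : ℤ) - (i : ℤ) - 2)

/-- The Castelnuovo–Mumford regularity `reg(I) = max { j - i | β_{i,j}(I) ≠ 0 }`
of the Stanley–Reisner ideal of `Δ` over `K`. -/
noncomputable def regSR (K : Type*) [Field K] {n : ℕ} (Δ : Finset (Finset (Fin n))) : ℕ :=
  sSup {d : ℕ | ∃ i j : ℕ, bettiNumber K Δ i j ≠ 0 ∧ (j : ℤ) - (i : ℤ) = d}

/-- The projective dimension `pd(I) = max { i | β_{i,j}(I) ≠ 0 for some j }`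
of the Stanley–Reisner ideal of `Δ` over `K`. -/
noncomputable def pdSR (K : Type*) [Field K] {n : ℕ} (Δ : Finset (Finset (Fin n))) : ℕ :=
  sSup {i : ℕ | ∃ j : ℕ, bettiNumber K Δ i j ≠ 0}

/-- The reduced Euler characteristic `χ̃(Δ) = ∑_{F ∈ Δ} (-1)^{|F| - 1}`
of a simplicial complex `Δ` (the alternating sum of the `f`-vector). -/
def eulerCharSR {n : ℕ} (Δ : Finset (Finset (Fin n))) : ℤ :=
  ∑ F ∈ Δ, (-1 : ℤ) ^ (F.card + 1)

/-- The incidence coefficients of the simplicial boundary compose to zero. -/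
lemma sum_bcoeff_mul_bcoeff (K : Type*) [Field K] {n : ℕ} (F H : Finset (Fin n)) :
    ∑ G, bcoeff K G H * bcoeff K F G = 0 := by
  have h1 : ∑ G, bcoeff K G H * bcoeff K F G =
      ∑ v ∈ F, bcoeff K (F.erase v) H * (-1 : K) ^ (F.filter (fun w => w < v)).card := by
    simp only [bcoeff.eq_def K F, Finset.mul_sum, mul_ite, mul_zero]
    rw [Finset.sum_comm]
    simp
  rw [h1]
  simp only [bcoeff, Finset.sum_mul]
  rw [Finset.sum_sigma']
  refine Finset.sum_involution (fun p _ => ⟨p.2, p.1⟩) ?_ ?_ ?_ ?_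
  · rintro ⟨v, w⟩ hp
    simp only [Finset.mem_sigma, Finset.mem_erase] at hp
    obtain ⟨hv, hwv, hw⟩ := hp
    simp only [Finset.erase_right_comm (a := w) (b := v)]
    split_ifs
    · rcases lt_or_gt_of_ne hwv with hlt | hlt
      · have e1 : ((F.erase v).filter (fun x => x < w)) = F.filter (fun x => x < w) := by
          ext x; simp only [Finset.mem_filter, Finset.mem_erase]; grind
        have e2 : (F.filter (fun x => x < v)).card =
            ((F.erase w).filter (fun x => x < v)).card + 1 := by
          rw [Finset.filter_erase, Finset.card_erase_add_one]
          simp [hw, hlt]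
        rw [e1, e2]; ring
      · have e1 : ((F.erase w).filter (fun x => x < v)) = F.filter (fun x => x < v) := by
          ext x; simp only [Finset.mem_filter, Finset.mem_erase]; grind
        have e2 : (F.filter (fun x => x < w)).card =
            ((F.erase v).filter (fun x => x < w)).card + 1 := by
          rw [Finset.filter_erase, Finset.card_erase_add_one]
          simp [hv, hlt]
        rw [e1, e2]; ring
    · simp
  · rintro ⟨v, w⟩ hp _ h
    simp only [Finset.mem_sigma, Finset.mem_erase] at hp
    simp only [Sigma.mk.injEq] at h
    exact hp.2.1 h.1
  · rintro ⟨v, w⟩ hp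
    simp only [Finset.mem_sigma, Finset.mem_erase] at hp ⊢
    exact ⟨hp.2.2, hp.2.1.symm, hp.1⟩
  · rintro ⟨v, w⟩ _
    rfl

lemma bcoeff_eq_zero_of_notMem (K : Type*) [Field K] {n : ℕ} {Δ : Finset (Finset (Fin n))}
    (hΔ : IsLowerSet (Δ : Set (Finset (Fin n)))) {m : ℕ} {F G : Finset (Fin n)}
    (hF : F ∈ cfaces Δ (m + 1)) (hG : G ∉ cfaces Δ m) : bcoeff K F G = 0 := by
  refine Finset.sum_eq_zero fun v hv => if_neg ?_
  rintro rfl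
  simp only [cfaces, Finset.mem_filter] at hF hG
  exact hG ⟨hΔ (Finset.erase_subset v F) hF.1, by rw [Finset.card_erase_of_mem hv, hF.2]; rfl⟩

lemma boundaryMap_comp (K : Type*) [Field K] {n : ℕ} {Δ : Finset (Finset (Fin n))}
    (hΔ : IsLowerSet (Δ : Set (Finset (Fin n)))) (m : ℕ) :
    boundaryMap K Δ m ∘ₗ boundaryMap K Δ (m + 1) = 0 := by
  ext c H
  obtain ⟨c, hc⟩ := c
  simp only [boundaryMap, LinearMap.comp_apply, LinearMap.pi_apply, LinearMap.sum_apply,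
    LinearMap.smul_apply, LinearMap.proj_apply, smul_eq_mul, LinearMap.zero_apply,
    Pi.zero_apply, LinearMap.single_apply, Pi.single_apply, mul_ite, mul_one, mul_zero,
    Finset.sum_ite_eq', Finset.mem_univ, if_true]
  rw [Finset.sum_coe_sort (cfaces Δ (m + 1)) (fun G => bcoeff K G H.1 * bcoeff K c G),
    ← sum_bcoeff_mul_bcoeff K c H.1]
  refine Finset.sum_subset (Finset.subset_univ _) fun G _ hG => ?_
  rw [bcoeff_eq_zero_of_notMem K hΔ hc hG, mul_zero]

lemma range_boundaryMap_zero_eq_top (K : Type*) [Field K] {n : ℕ} {Δ : Finset (Finset (Fin n))}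
    (h : reducedHomologyRank K Δ (-1) = 0) : LinearMap.range (boundaryMap K Δ 0) = ⊤ := by
  rw [reducedHomologyRank, if_pos rfl, Module.finrank_zero_iff,
    Submodule.Quotient.subsingleton_iff] at h
  exact h

lemma ker_boundaryMap_eq_range (K : Type*) [Field K] {n : ℕ} {Δ : Finset (Finset (Fin n))}
    (hΔ : IsLowerSet (Δ : Set (Finset (Fin n)))) {m : ℕ} (h : reducedHomologyRank K Δ m = 0) :
    LinearMap.ker (boundaryMap K Δ m) = LinearMap.range (boundaryMap K Δ (m + 1)) := by
  rw [reducedHomologyRank, if_neg (by omega), if_pos (by omega), Module.finrank_zero_iff,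
    Submodule.Quotient.subsingleton_iff, Submodule.comap_subtype_eq_top] at h
  exact le_antisymm h (LinearMap.range_le_ker_iff.2 (boundaryMap_comp K hΔ m))

lemma eulerCharSR_eq_sum_card_cfaces {n : ℕ} {Δ : Finset (Finset (Fin n))} {N : ℕ}
    (hN : ∀ F ∈ Δ, F.card ≤ N) :
    eulerCharSR Δ = ∑ m ∈ Finset.range (N + 1), (-1 : ℤ) ^ (m + 1) * (cfaces Δ m).card := by
  rw [eulerCharSR, ← Finset.sum_fiberwise_of_maps_to (s := Δ) (t := Finset.range (N + 1))
    (g := Finset.card) (fun F hF => Finset.mem_range.2 (Nat.lt_succ_of_le (hN F hF)))]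
  refine Finset.sum_congr rfl fun m _ => ?_
  rw [Finset.sum_congr rfl fun F hF => by rw [(Finset.mem_filter.1 hF).2]]
  simp [cfaces, mul_comm]

/-- A complex whose faces have at most `N` vertices and whose reduced homology vanishes below
degree `N` has vanishing reduced Euler characteristic. -/
lemma eulerCharSR_eq_zero (K : Type*) [Field K] {n : ℕ} {Δ : Finset (Finset (Fin n))}
    (hΔ : IsLowerSet (Δ : Set (Finset (Fin n)))) {N : ℕ} (hN : ∀ F ∈ Δ, F.card ≤ N)
    (h : ∀ i : ℤ, -1 ≤ i → i < N → reducedHomologyRank K Δ i = 0) : eulerCharSR Δ = 0 := by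
  have key : ∀ M ≤ N, ∑ m ∈ Finset.range (M + 1), (-1 : ℤ) ^ (m + 1) * (cfaces Δ m).card =
      (-1) ^ (M + 1) * Module.finrank K (LinearMap.range (boundaryMap K Δ M)) := by
    intro M
    induction M with
    | zero =>
      intro _
      rw [range_boundaryMap_zero_eq_top K (h (-1) le_rfl (by omega))]
      simp
    | succ M ih =>
      intro hM
      have hr := LinearMap.finrank_range_add_finrank_ker (boundaryMap K Δ M)
      rw [ker_boundaryMap_eq_range K hΔ (h M (by omega) (by omega)),
        Module.finrank_fintype_fun_eq_card, Fintype.card_coe] at hr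
      rw [Finset.sum_range_succ, ih (by omega), ← hr]
      push_cast
      ring
  have hempty : cfaces Δ (N + 1) = ∅ :=
    Finset.filter_eq_empty_iff.2 fun F hF hc => by have := hN F hF; omega
  have : IsEmpty {F // F ∈ cfaces Δ (N + 1)} :=
    Finset.isEmpty_coe_sort.2 hempty
  rw [eulerCharSR_eq_sum_card_cfaces hN, key N le_rfl,
    Subsingleton.elim (boundaryMap K Δ N) 0]
  simp

/-- The full simplex on a nonempty vertex set has vanishing reduced Euler characteristic. -/
lemma eulerCharSR_eq_zero_of_univ_mem {n : ℕ} (hn : n ≠ 0) {Δ : Finset (Finset (Fin n))}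
    (hΔ : IsLowerSet (Δ : Set (Finset (Fin n)))) (h : Finset.univ ∈ Δ) : eulerCharSR Δ = 0 := by
  have : NeZero n := ⟨hn⟩
  have hΔ' : Δ = (Finset.univ : Finset (Fin n)).powerset :=
    Finset.ext fun F => by simpa using hΔ (Finset.subset_univ F) h
  simp only [eulerCharSR, pow_succ, ← Finset.sum_mul, hΔ',
    Finset.sum_powerset_neg_one_pow_card_of_nonempty Finset.univ_nonempty, zero_mul]

lemma exists_reducedHomologyRank_ne_zero (K : Type*) [Field K] {n : ℕ} (hn : n ≠ 0)
    {Δ : Finset (Finset (Fin n))} (hΔ : IsLowerSet (Δ : Set (Finset (Fin n))))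
    (hχ : eulerCharSR Δ ≠ 0) :
    ∃ i : ℤ, -1 ≤ i ∧ i + 2 ≤ n ∧ reducedHomologyRank K Δ i ≠ 0 := by
  by_contra! hvanish
  refine hχ (eulerCharSR_eq_zero K hΔ (N := n - 1) (fun F hF => ?_)
    fun i hi hi' => hvanish i hi (by omega))
  by_contra! hcard
  have hle : F.card ≤ n := by simpa using F.card_le_univ
  have hF' : F = Finset.univ := F.card_eq_iff_eq_univ.1 (by simp; omega)
  exact hχ (eulerCharSR_eq_zero_of_univ_mem hn hΔ (hF' ▸ hF))

/-- A nonzero Betti number `β_{i,j}` satisfies `i < j ≤ n`. -/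
lemma lt_and_le_of_bettiNumber_ne_zero (K : Type*) [Field K] {n : ℕ}
    {Δ : Finset (Finset (Fin n))} {i j : ℕ} (h : bettiNumber K Δ i j ≠ 0) : i < j ∧ j ≤ n := by
  obtain ⟨W, hW, hne⟩ := Finset.exists_ne_zero_of_sum_ne_zero h
  have hcard : W.card ≤ n := by simpa using W.card_le_univ
  rw [(Finset.mem_powersetCard.1 hW).2] at hcard
  refine ⟨?_, hcard⟩
  by_contra! hij
  exact hne (by rw [reducedHomologyRank, if_neg (by omega), if_neg (by omega)])

lemma le_regSR (K : Type*) [Field K] {n : ℕ} {Δ : Finset (Finset (Fin n))} {i j : ℕ}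
    (h : bettiNumber K Δ i j ≠ 0) : j - i ≤ regSR K Δ := by
  refine le_csSup ⟨n, ?_⟩ ⟨i, j, h, ?_⟩
  · rintro d ⟨a, b, hab, hd⟩
    have := lt_and_le_of_bettiNumber_ne_zero K hab
    omega
  · have := lt_and_le_of_bettiNumber_ne_zero K h
    omega

lemma le_pdSR (K : Type*) [Field K] {n : ℕ} {Δ : Finset (Finset (Fin n))} {i j : ℕ}
    (h : bettiNumber K Δ i j ≠ 0) : i ≤ pdSR K Δ := by
  refine le_csSup ⟨n, ?_⟩ ⟨j, h⟩
  rintro a ⟨b, hab⟩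
  have := lt_and_le_of_bettiNumber_ne_zero K hab
  omega

lemma bettiNumber_card (K : Type*) [Field K] {n : ℕ} (Δ : Finset (Finset (Fin n))) (i : ℕ) :
    bettiNumber K Δ i n = reducedHomologyRank K Δ ((n : ℤ) - i - 2) := by
  have h : Finset.powersetCard n (Finset.univ : Finset (Fin n)) = {Finset.univ} := by
    simpa using Finset.powersetCard_self (Finset.univ : Finset (Fin n))
  simp [bettiNumber, h]

/-- **Theorem (new regularity result, part (ii)).**
Let `I` be a square-free monomial ideal of `R = K[x_1, …, x_n]` with associated
Stanley–Reisner simplicial complex `Δ = Δ(I)`.  Suppose `reg(I) ≤ r` and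
`pd(I) ≤ n - r`.  If `χ̃(Δ) ≠ 0`, then `reg(I) = r`. -/
theorem regularity_of_squarefree_monomial_ideal_nonzero_euler
    (K : Type*) [Field K] (n r : ℕ)
    (I : Ideal (MvPolynomial (Fin n) K))
    (hsq : ∃ S : Set (Finset (Fin n)),
      I = Ideal.span ((fun F : Finset (Fin n) => ∏ v ∈ F, MvPolynomial.X v) '' S))
    (Δ : Finset (Finset (Fin n)))
    (hΔ : ∀ F : Finset (Fin n),
      F ∈ Δ ↔ (∏ v ∈ F, MvPolynomial.X v : MvPolynomial (Fin n) K) ∉ I)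
    (hreg : regSR K Δ ≤ r)
    (hpd : (pdSR K Δ : ℤ) ≤ (n : ℤ) - (r : ℤ))
    (hχ : eulerCharSR Δ ≠ 0) :
    regSR K Δ = r := by
  rcases eq_or_ne n 0 with rfl | hn
  · omega
  have hlow : IsLowerSet (Δ : Set (Finset (Fin n))) := fun F G hGF hF => by
    rw [Finset.mem_coe, hΔ] at hF ⊢
    exact fun hG => hF (I.mem_of_dvd (Finset.prod_dvd_prod_of_subset _ _ _ hGF) hG)
  obtain ⟨h, h1, h2, hne⟩ := exists_reducedHomologyRank_ne_zero K hn hlow hχ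
  obtain ⟨i, hi⟩ := Int.eq_ofNat_of_zero_le (show 0 ≤ (n : ℤ) - h - 2 by omega)
  have hb : bettiNumber K Δ i n ≠ 0 := by
    rwa [bettiNumber_card, show (n : ℤ) - i - 2 = h by omega]
  have := le_regSR K hb
  have := le_pdSR K hb
  omega
end

section
/- Let t ≥ 1 and let A_t be the graph consisting of a ladder with t squares together with a pendant edge extending each of the two paths at one end: vertices a_0, ..., a_{t+1} and b_0, ..., b_{t+1}, with edges a_i a_{i+1} and b_i b_{i+1} for 0 ≤ i ≤ t, and rungs a_i b_i for 1 ≤ i ≤ t+1. Then the edge ideal I(A_t) satisfies pd(I(A_t)) ≤ 3t/2 + 1 if t is even and pd(I(A_t)) ≤ 3(t-1)/2 + 2 if t is odd. -/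
/-- The circulant graph `C_n(S)`: the graph on the vertex set `ZMod n`
(identified with `{x_1, …, x_n}`) in which `x` and `y` are adjacent if and only
if they differ by `±s (mod n)` for some `s ∈ S`. -/
def circulant (n : ℕ) (S : Set ℕ) : SimpleGraph (ZMod n) :=
  SimpleGraph.fromRel (fun x y => ∃ s ∈ S, y - x = (s : ZMod n))

/-- A graph is chordal if it has no induced cycle of length `m ≥ 4`.  Here an
induced `m`-cycle is an injection of the cycle `C_m = C_m(1)` whose image
induces exactly the cycle's adjacency. -/
def IsChordal {V : Type*} (G : SimpleGraph V) : Prop :=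
  ∀ m : ℕ, 4 ≤ m → ¬ ∃ f : ZMod m → V, Function.Injective f ∧
    ∀ a b : ZMod m, G.Adj (f a) (f b) ↔ (circulant m {1}).Adj a b

/-- A graph is claw-free if it has no induced subgraph isomorphic to the claw
`K_{1,3}`, i.e. there is no vertex adjacent to three pairwise non-adjacent
vertices. -/
def ClawFree {V : Type*} (G : SimpleGraph V) : Prop :=
  ¬ ∃ c x y z : V, x ≠ y ∧ x ≠ z ∧ y ≠ z ∧
    G.Adj c x ∧ G.Adj c y ∧ G.Adj c z ∧ ¬ G.Adj x y ∧ ¬ G.Adj x z ∧ ¬ G.Adj y z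

open Classical in
/-- The independence complex `Ind(G)` of a finite simple graph `G`, recorded
as a simplicial complex on `Fin (card V)` via a fixed identification of the
vertices with `Fin (card V)`.  It is the Stanley–Reisner complex of the edge
ideal `I(G)`. -/
noncomputable def indComplex {V : Type*} [Fintype V] (G : SimpleGraph V) :
    Finset (Finset (Fin (Fintype.card V))) :=
  Finset.univ.filter (fun F : Finset (Fin (Fintype.card V)) =>
    ∀ u ∈ F, ∀ v ∈ F,
      ¬ G.Adj ((Fintype.equivFin V).symm u) ((Fintype.equivFin V).symm v))

/-- The Castelnuovo–Mumford regularity `reg(I(G))` of the edge ideal of the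
finite simple graph `G` over the field `K`, computed (via Hochster's formula)
from the independence complex of `G`. -/
noncomputable def regEdgeIdeal (K : Type*) [Field K] {V : Type*} [Fintype V]
    (G : SimpleGraph V) : ℕ :=
  regSR K (indComplex G)

/-- The projective dimension `pd(I(G))` of the edge ideal of the finite simple
graph `G` over the field `K`, computed (via Hochster's formula) from the
independence complex of `G`. -/
noncomputable def pdEdgeIdeal (K : Type*) [Field K] {V : Type*} [Fintype V]
    (G : SimpleGraph V) : ℕ :=
  pdSR K (indComplex G)

/-- The graph `A_t`: a ladder with `t` squares together with a pendant edge
extending each of the two horizontal paths at one end.  The vertices are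
`a_0, …, a_{t+1}` (the row `(true, i) = a_i`) and `b_0, …, b_{t+1}` (the row
`(false, i) = b_i`), with edges `a_i a_{i+1}` and `b_i b_{i+1}` for
`0 ≤ i ≤ t`, and rungs `a_i b_i` for `1 ≤ i ≤ t+1`. -/
def graphA (t : ℕ) : SimpleGraph (Bool × Fin (t + 2)) :=
  SimpleGraph.fromRel (fun x y =>
    (x.1 = y.1 ∧ (y.2 : ℕ) = (x.2 : ℕ) + 1) ∨
    (x.2 = y.2 ∧ 1 ≤ (x.2 : ℕ) ∧ x.1 ≠ y.1))

/-- The ladder graph `B_t` with `t` squares: vertices `a_1, …, a_{t+1}` (the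
row `(true, i) = a_{i+1}`) and `b_1, …, b_{t+1}` (the row
`(false, i) = b_{i+1}`), with edges `a_i a_{i+1}` and `b_i b_{i+1}` for
`1 ≤ i ≤ t`, and rungs `a_i b_i` for `1 ≤ i ≤ t+1`. -/
def graphB (t : ℕ) : SimpleGraph (Bool × Fin (t + 1)) :=
  SimpleGraph.fromRel (fun x y =>
    (x.1 = y.1 ∧ (y.2 : ℕ) = (x.2 : ℕ) + 1) ∨
    (x.2 = y.2 ∧ x.1 ≠ y.1))

/-- The graph `D_t`: a ladder with `t` squares together with one pendant edge
extending the bottom path on the left and one pendant edge extending the top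
path on the right.  The vertices are `a_1, …, a_{t+2}` (the top row
`(true, i) = a_{i+1}`) and `b_0, …, b_{t+1}` (the bottom row
`(false, i) = b_i`), with edges `a_i a_{i+1}` for `1 ≤ i ≤ t+1`, edges
`b_i b_{i+1}` for `0 ≤ i ≤ t`, and rungs `a_i b_i` for `1 ≤ i ≤ t+1`. -/
def graphD (t : ℕ) : SimpleGraph (Bool × Fin (t + 2)) :=
  SimpleGraph.fromRel (fun x y =>
    (y.2 : ℕ) = (x.2 : ℕ) + 1 ∧ (x.1 = y.1 ∨ (x.1 = true ∧ y.1 = false)))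

section Homology

variable {K : Type*} [Field K] {n : ℕ}

/-- The sign `(-1)^{#{u ∈ G | u < w}}` of `G` in the boundary of `insert w G`. -/
def insertSign (K : Type*) [Field K] {n : ℕ} (w : Fin n) (G : Finset (Fin n)) : K :=
  (-1) ^ (G.filter (fun u => u < w)).card

/-- The simplicial boundary on all functions on finite subsets of `Fin n`. -/
def totalBoundary (c : Finset (Fin n) → K) (G : Finset (Fin n)) : K :=
  ∑ w ∈ Gᶜ, insertSign K w G * c (insert w G)

/-- The cone operator with apex `v`. -/
def coneChain (v : Fin n) (c : Finset (Fin n) → K) (F : Finset (Fin n)) : K :=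
  if v ∈ F then insertSign K v (F.erase v) * c (F.erase v) else 0

/-- The chain `c` is supported on the faces of `Δ` of cardinality `m`. -/
def IsChainOn (Δ : Finset (Finset (Fin n))) (m : ℕ) (c : Finset (Fin n) → K) : Prop :=
  ∀ F, c F ≠ 0 → F ∈ cfaces Δ m

/-- The augmented chain complex of `Δ` is exact at the faces of cardinality `m`. -/
def ExactAt (K : Type*) [Field K] {n : ℕ} (Δ : Finset (Finset (Fin n))) (m : ℕ) : Prop :=
  ∀ z : Finset (Fin n) → K, IsChainOn Δ m z → totalBoundary z = 0 →
    ∃ y, IsChainOn Δ (m + 1) y ∧ totalBoundary y = z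

lemma insertSign_mul_self (v : Fin n) (G : Finset (Fin n)) :
    insertSign K v G * insertSign K v G = 1 := by
  unfold insertSign
  rw [← pow_add, ← two_mul, pow_mul]
  simp

lemma insertSign_swap {v w : Fin n} (hvw : v ≠ w) {G : Finset (Fin n)} (hv : v ∉ G)
    (hw : w ∉ G) :
    insertSign K w (insert v G) * insertSign K v (insert w G) =
      -(insertSign K v G * insertSign K w G) := by
  unfold insertSign
  rcases lt_or_gt_of_ne hvw with h | h
  · rw [Finset.filter_insert, Finset.filter_insert, if_pos h, if_neg h.not_gt,
      Finset.card_insert_of_notMem (by simp [hv]), pow_succ]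
    ring
  · rw [Finset.filter_insert, Finset.filter_insert, if_pos h, if_neg h.not_gt,
      Finset.card_insert_of_notMem (by simp [hw]), pow_succ]
    ring

lemma totalBoundary_add (c d : Finset (Fin n) → K) :
    totalBoundary (c + d) = totalBoundary c + totalBoundary d := by
  funext G
  simp [totalBoundary, mul_add, Finset.sum_add_distrib]

lemma totalBoundary_sub (c d : Finset (Fin n) → K) :
    totalBoundary (c - d) = totalBoundary c - totalBoundary d := by
  funext G
  simp [totalBoundary, mul_sub, Finset.sum_sub_distrib]

lemma totalBoundary_coneChain (v : Fin n) (c : Finset (Fin n) → K)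
    (hc : ∀ F, v ∈ F → c F = 0) :
    totalBoundary (coneChain v c) = c - coneChain v (totalBoundary c) := by
  funext G
  by_cases hv : v ∈ G
  · obtain ⟨H, hvH, rfl⟩ : ∃ H, v ∉ H ∧ insert v H = G :=
      ⟨G.erase v, by simp, Finset.insert_erase hv⟩
    have hcompl : (H : Finset (Fin n))ᶜ = insert v (insert v H)ᶜ := by
      ext x
      by_cases hx : x = v <;> simp [hx, hvH]
    simp only [Pi.sub_apply, hc _ hv, coneChain, hv, if_true, Finset.erase_insert hvH,
      totalBoundary, zero_sub]
    rw [hcompl, Finset.sum_insert (by simp), hc _ hv, mul_zero, zero_add, Finset.mul_sum,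
      ← Finset.sum_neg_distrib]
    refine Finset.sum_congr rfl fun w hw => ?_
    have hw' : w ≠ v ∧ w ∉ H := by simpa using hw
    have he : (insert w (insert v H)).erase v = insert w H := by
      rw [Finset.insert_comm, Finset.erase_insert]
      simp [hvH, hw'.1.symm]
    rw [if_pos (by simp), he, ← mul_assoc, insertSign_swap hw'.1.symm hvH hw'.2]
    ring
  · simp only [Pi.sub_apply, coneChain, hv, if_false, sub_zero, totalBoundary]
    rw [Finset.sum_eq_single_of_mem v (by simpa using hv)]
    · rw [if_pos (by simp), Finset.erase_insert hv, ← mul_assoc, insertSign_mul_self, one_mul]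
    · intro w _ hw
      rw [if_neg (by simp [hv, hw.symm]), mul_zero]

/-- The part of a chain on the faces avoiding `v`. -/
def avoidPart (v : Fin n) (z : Finset (Fin n) → K) (F : Finset (Fin n)) : K :=
  if v ∈ F then 0 else z F

/-- The link part of a chain at `v`. -/
def linkPart (v : Fin n) (z : Finset (Fin n) → K) (F : Finset (Fin n)) : K :=
  if v ∈ F then 0 else insertSign K v F * z (insert v F)

lemma avoidPart_add_coneChain_linkPart (v : Fin n) (z : Finset (Fin n) → K) :
    avoidPart v z + coneChain v (linkPart v z) = z := by
  funext F
  by_cases hv : v ∈ F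
  · simp [avoidPart, coneChain, linkPart, hv, Finset.insert_erase hv, ← mul_assoc,
      insertSign_mul_self]
  · simp [avoidPart, coneChain, hv]

lemma totalBoundary_eq_zero_of_mem {v : Fin n} {c : Finset (Fin n) → K}
    (hc : ∀ F, v ∈ F → c F = 0) {G : Finset (Fin n)} (hG : v ∈ G) : totalBoundary c G = 0 :=
  Finset.sum_eq_zero fun w _ => by rw [hc _ (Finset.mem_insert_of_mem hG), mul_zero]

/-- The components of the boundary of a cycle, without `v` and with `v`. -/
lemma boundary_parts_of_cycle (v : Fin n) {z : Finset (Fin n) → K} (hz : totalBoundary z = 0) :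
    totalBoundary (avoidPart v z) + linkPart v z = 0 ∧ totalBoundary (linkPart v z) = 0 := by
  have h0 : ∀ F, v ∈ F → avoidPart v z F = 0 := fun F hF => if_pos hF
  have h1 : ∀ F, v ∈ F → linkPart v z F = 0 := fun F hF => if_pos hF
  have key : totalBoundary (avoidPart v z) +
      (linkPart v z - coneChain v (totalBoundary (linkPart v z))) = 0 := by
    rw [← totalBoundary_coneChain v _ h1, ← totalBoundary_add,
      avoidPart_add_coneChain_linkPart, hz]
  constructor
  · funext G
    by_cases hG : v ∈ G
    · simp [totalBoundary_eq_zero_of_mem h0 hG, h1 G hG]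
    · simpa [coneChain, hG] using congrFun key G
  · funext G
    by_cases hG : v ∈ G
    · exact totalBoundary_eq_zero_of_mem h1 hG
    · have := congrFun key (insert v G)
      rw [Pi.add_apply, Pi.sub_apply, totalBoundary_eq_zero_of_mem h0 (by simp),
        h1 _ (by simp)] at this
      have h2 : insertSign K v G * totalBoundary (linkPart v z) G = 0 := by
        simpa [coneChain, hG] using this
      rcases mul_eq_zero.1 h2 with h | h
      · have h3 := insertSign_mul_self (K := K) v G
        simp [h] at h3
      · exact h

variable {Δ D L : Finset (Finset (Fin n))} {m : ℕ}

lemma IsChainOn.add {c d : Finset (Fin n) → K} (hc : IsChainOn Δ m c) (hd : IsChainOn Δ m d) :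
    IsChainOn Δ m (c + d) := by
  intro F hF
  by_cases h : c F = 0
  · exact hd F (by simpa [h] using hF)
  · exact hc F h

lemma IsChainOn.sub {c d : Finset (Fin n) → K} (hc : IsChainOn Δ m c) (hd : IsChainOn Δ m d) :
    IsChainOn Δ m (c - d) := by
  intro F hF
  by_cases h : c F = 0
  · exact hd F (by simpa [h] using hF)
  · exact hc F h

lemma IsChainOn.mono {c : Finset (Fin n) → K} (hc : IsChainOn D m c) (h : D ⊆ Δ) :
    IsChainOn Δ m c := fun F hF => by
  have := hc F hF
  simp only [cfaces, Finset.mem_filter] at this ⊢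
  exact ⟨h this.1, this.2⟩

lemma IsChainOn.avoidPart {z : Finset (Fin n) → K} (hz : IsChainOn Δ m z) {v : Fin n}
    (hD : ∀ F ∈ Δ, v ∉ F → F ∈ D) : IsChainOn D m (avoidPart v z) := by
  intro F hF
  by_cases hv : v ∈ F
  · simp [_root_.avoidPart, hv] at hF
  · have := hz F (by simpa [_root_.avoidPart, hv] using hF)
    simp only [cfaces, Finset.mem_filter] at this ⊢
    exact ⟨hD F this.1 hv, this.2⟩

lemma IsChainOn.linkPart {z : Finset (Fin n) → K} (hz : IsChainOn Δ (m + 1) z) {v : Fin n}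
    (hL : ∀ F, v ∉ F → insert v F ∈ Δ → F ∈ L) : IsChainOn L m (linkPart v z) := by
  intro F hF
  by_cases hv : v ∈ F
  · simp [_root_.linkPart, hv] at hF
  · have := hz (insert v F) (by
      intro h
      simp [_root_.linkPart, hv, h] at hF)
    simp only [cfaces, Finset.mem_filter] at this ⊢
    rw [Finset.card_insert_of_notMem hv] at this
    exact ⟨hL F hv this.1, by omega⟩

lemma IsChainOn.coneChain {c : Finset (Fin n) → K} (hc : IsChainOn L m c) {v : Fin n}
    (hL : ∀ F ∈ L, insert v F ∈ Δ) : IsChainOn Δ (m + 1) (coneChain v c) := by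
  intro F hF
  by_cases hv : v ∈ F
  · have := hc (F.erase v) (by
      intro h
      simp [_root_.coneChain, h] at hF)
    simp only [cfaces, Finset.mem_filter] at this ⊢
    have h1 := hL _ this.1
    rw [Finset.insert_erase hv] at h1
    exact ⟨h1, by rw [← this.2, Finset.card_erase_add_one hv]⟩
  · simp [_root_.coneChain, hv] at hF

/-- A complex with a cone point is exact. -/
lemma exactAt_of_cone (v : Fin n) (hΔ : ∀ F ∈ Δ, insert v F ∈ Δ) : ExactAt K Δ m := by
  intro z hz hbz
  refine ⟨coneChain v (avoidPart v z),
    (hz.avoidPart (v := v) (D := Δ) fun F hF _ => hF).coneChain hΔ, ?_⟩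
  rw [totalBoundary_coneChain v (avoidPart v z) fun F hF => if_pos hF]
  have h1 := (boundary_parts_of_cycle v hbz).1
  have h2 : totalBoundary (avoidPart v z) = -linkPart v z := eq_neg_of_add_eq_zero_left h1
  have h3 : coneChain v (-linkPart v z) = -coneChain v (linkPart v z) := by
    funext F
    by_cases hv : v ∈ F <;> simp [coneChain, hv]
  rw [h2, h3, sub_neg_eq_add, avoidPart_add_coneChain_linkPart]

/-- Exactness of the deletion `D` and of the link `L` of a vertex implies exactness of `Δ`. -/
lemma exactAt_of_deletion_link (v : Fin n) (hDΔ : D ⊆ Δ) (hD : ∀ F ∈ Δ, v ∉ F → F ∈ D)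
    (hL : ∀ F, v ∉ F → insert v F ∈ Δ → F ∈ L) (hLD : L ⊆ D)
    (hvL : ∀ F ∈ L, v ∉ F) (hLΔ : ∀ F ∈ L, insert v F ∈ Δ) (hexD : ExactAt K D m)
    (hexL : ∀ k, m = k + 1 → ExactAt K L k) : ExactAt K Δ m := by
  intro z hz hbz
  obtain ⟨h01, h1⟩ := boundary_parts_of_cycle v hbz
  obtain ⟨y, hy, hby⟩ : ∃ y, IsChainOn L m y ∧ totalBoundary y = linkPart v z := by
    cases m with
    | zero =>
      refine ⟨0, fun F hF => absurd rfl hF, ?_⟩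
      have : linkPart v z = 0 := by
        funext F
        by_cases hv : v ∈ F
        · simp [linkPart, hv]
        · have : z (insert v F) = 0 := by
            by_contra h
            simpa [cfaces] using hz _ h
          simp [linkPart, this]
      rw [this]
      funext G
      simp [totalBoundary]
    | succ k => exact hexL k rfl _ (hz.linkPart hL) h1
  obtain ⟨x, hx, hbx⟩ := hexD (avoidPart v z + y) ((hz.avoidPart hD).add (hy.mono hLD)) (by
    rw [totalBoundary_add, hby, h01])
  refine ⟨x - coneChain v y, (hx.mono hDΔ).sub (hy.coneChain hLΔ), ?_⟩
  rw [totalBoundary_sub, hbx, totalBoundary_coneChain v y, hby]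
  · nth_rewrite 3 [← avoidPart_add_coneChain_linkPart v z]
    abel
  · intro F hF
    by_contra h
    exact hvL F (Finset.mem_filter.1 (hy F h)).1 hF

lemma sum_bcoeff_mul (c : Finset (Fin n) → K) (G : Finset (Fin n)) :
    ∑ F, bcoeff K F G * c F = totalBoundary c G := by
  have h : ∀ F : Finset (Fin n), bcoeff K F G * c F =
      ∑ v, if v ∈ F ∧ F.erase v = G then insertSign K v G * c F else 0 := by
    intro F
    rw [bcoeff, Finset.sum_mul, ← Finset.sum_filter_of_ne (s := Finset.univ) (p := (· ∈ F))]
    · rw [Finset.filter_univ_mem]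
      refine Finset.sum_congr rfl fun v hv => ?_
      by_cases he : F.erase v = G
      · have : F.filter (fun w => w < v) = G.filter (fun w => w < v) := by
          rw [← he]
          ext x
          simp only [Finset.mem_filter, Finset.mem_erase]
          exact ⟨fun h => ⟨⟨h.2.ne, h.1⟩, h.2⟩, fun h => ⟨h.1.2, h.2⟩⟩
        simp [hv, he, insertSign, this]
      · simp [he]
    · intro v _ hne
      by_contra hv
      exact hne (if_neg fun h => hv h.1)
  simp only [h]
  rw [Finset.sum_comm, totalBoundary, ← Finset.sum_filter_of_ne (s := Finset.univ) (p := (· ∈ Gᶜ))]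
  · rw [Finset.filter_univ_mem]
    refine Finset.sum_congr rfl fun v hv => ?_
    have hv' : v ∉ G := by simpa using hv
    rw [Finset.sum_eq_single (insert v G)]
    · simp [hv']
    · intro F _ hF
      refine if_neg fun h => hF ?_
      rw [← h.2, Finset.insert_erase h.1]
    · simp
  · intro v _ hne
    obtain ⟨F, _, hF⟩ := Finset.exists_ne_zero_of_sum_ne_zero hne
    have : v ∈ F ∧ F.erase v = G := by
      by_contra h
      exact hF (if_neg h)
    simp [← this.2]

/-- Extension of a chain by zero. -/
noncomputable def extendChain (Δ : Finset (Finset (Fin n))) (m : ℕ)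
    (f : {F // F ∈ cfaces Δ m} → K) (F : Finset (Fin n)) : K :=
  if h : F ∈ cfaces Δ m then f ⟨F, h⟩ else 0

lemma isChainOn_extendChain (f : {F // F ∈ cfaces Δ m} → K) :
    IsChainOn Δ m (extendChain Δ m f) := by
  intro F hF
  by_contra h
  exact hF (dif_neg h)

lemma boundaryMap_apply_eq (f : {F // F ∈ cfaces Δ (m + 1)} → K) (G : {G // G ∈ cfaces Δ m}) :
    boundaryMap K Δ m f G = totalBoundary (extendChain Δ (m + 1) f) G.1 := by
  rw [← sum_bcoeff_mul, ← Finset.sum_subset (Finset.subset_univ (cfaces Δ (m + 1))),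
    ← Finset.sum_coe_sort]
  · simp [boundaryMap, extendChain, LinearMap.sum_apply]
  · intro F _ hF
    simp [extendChain, hF]

lemma IsChainOn.totalBoundary {c : Finset (Fin n) → K} (hc : IsChainOn Δ (m + 1) c)
    (hΔ : ∀ F ∈ Δ, ∀ G ⊆ F, G ∈ Δ) : IsChainOn Δ m (totalBoundary c) := by
  intro G hG
  obtain ⟨w, hw, hne⟩ := Finset.exists_ne_zero_of_sum_ne_zero hG
  have := hc _ (right_ne_zero_of_mul hne)
  simp only [cfaces, Finset.mem_filter] at this ⊢
  rw [Finset.card_insert_of_notMem (by simpa using hw)] at this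
  exact ⟨hΔ _ this.1 _ (Finset.subset_insert _ _), by omega⟩

lemma exists_boundaryMap_eq (hex : ExactAt K Δ m)
    (f : {F // F ∈ cfaces Δ m} → K) (hf : totalBoundary (extendChain Δ m f) = 0) :
    ∃ g, boundaryMap K Δ m g = f := by
  obtain ⟨y, hy, hby⟩ := hex _ (isChainOn_extendChain f) hf
  refine ⟨fun F => y F.1, ?_⟩
  funext G
  have : extendChain Δ (m + 1) (fun F => y F.1) = y := by
    funext F
    by_cases h : F ∈ cfaces Δ (m + 1)
    · simp [extendChain, h]
    · have : y F = 0 := by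
        by_contra h'
        exact h (hy F h')
      simp [extendChain, h, this]
  rw [boundaryMap_apply_eq, this, hby]
  simp [extendChain]

lemma reducedHomologyRank_eq_zero (hΔ : ∀ F ∈ Δ, ∀ G ⊆ F, G ∈ Δ) (hex : ExactAt K Δ m) :
    reducedHomologyRank K Δ ((m : ℤ) - 1) = 0 := by
  cases m with
  | zero =>
    have hr : LinearMap.range (boundaryMap K Δ 0) = ⊤ := by
      rw [LinearMap.range_eq_top]
      intro f
      refine exists_boundaryMap_eq hex f ?_
      funext G
      refine Finset.sum_eq_zero fun w _ => ?_
      rw [extendChain, dif_neg (by simp [cfaces]), mul_zero]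
    simp only [reducedHomologyRank, Nat.cast_zero, zero_sub, if_true]
    rw [hr]
    have : Subsingleton (({F // F ∈ cfaces Δ 0} → K) ⧸
        (⊤ : Submodule K ({F // F ∈ cfaces Δ 0} → K))) :=
      Submodule.Quotient.subsingleton_iff.2 rfl
    exact Module.finrank_zero_of_subsingleton
  | succ k =>
    have hk : ((k + 1 : ℕ) : ℤ) - 1 = k := by push_cast; ring
    rw [hk, reducedHomologyRank, if_neg (by omega), if_pos (by omega), Int.toNat_natCast]
    have hr : Submodule.comap (LinearMap.ker (boundaryMap K Δ k)).subtype
        (LinearMap.range (boundaryMap K Δ (k + 1))) = ⊤ := by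
      rw [eq_top_iff]
      rintro ⟨f, hf⟩ -
      refine exists_boundaryMap_eq hex f ?_
      funext G
      by_cases hG : G ∈ cfaces Δ k
      · rw [← boundaryMap_apply_eq f ⟨G, hG⟩, LinearMap.mem_ker.1 hf]
        rfl
      · by_contra h
        exact hG ((isChainOn_extendChain f).totalBoundary hΔ G h)
    rw [hr]
    have : Subsingleton (LinearMap.ker (boundaryMap K Δ k) ⧸
        (⊤ : Submodule K (LinearMap.ker (boundaryMap K Δ k)))) :=
      Submodule.Quotient.subsingleton_iff.2 rfl
    exact Module.finrank_zero_of_subsingleton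

end Homology

section Independence

variable {K : Type*} [Field K] {n : ℕ} {U : Type*} {H : SimpleGraph U} {φ : Fin n → U}

open Classical in
/-- The independent subsets of `W` in the graph pulled back along `φ`. -/
noncomputable def indepIn (H : SimpleGraph U) (φ : Fin n → U) (W : Finset (Fin n)) :
    Finset (Finset (Fin n)) :=
  Finset.univ.filter fun F => F ⊆ W ∧ ∀ u ∈ F, ∀ v ∈ F, ¬ H.Adj (φ u) (φ v)

lemma mem_indepIn {W F : Finset (Fin n)} :
    F ∈ indepIn H φ W ↔ F ⊆ W ∧ ∀ u ∈ F, ∀ v ∈ F, ¬ H.Adj (φ u) (φ v) := by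
  simp [indepIn]

lemma insert_mem_indepIn {W F : Finset (Fin n)} {v : Fin n} (hv : v ∈ W)
    (hF : F ∈ indepIn H φ W) (h : ∀ u ∈ F, ¬ H.Adj (φ v) (φ u)) :
    insert v F ∈ indepIn H φ W := by
  rw [mem_indepIn] at hF ⊢
  refine ⟨Finset.insert_subset hv hF.1, ?_⟩
  simp only [Finset.forall_mem_insert]
  exact ⟨⟨H.loopless.irrefl _, h⟩, fun u hu => ⟨fun h' => h u hu h'.symm, hF.2 u hu⟩⟩

lemma exactAt_indepIn_of_isolated {W : Finset (Fin n)} {v : Fin n} (hv : v ∈ W)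
    (h : ∀ u ∈ W, ¬ H.Adj (φ v) (φ u)) (m : ℕ) : ExactAt K (indepIn H φ W) m :=
  exactAt_of_cone v fun _ hF =>
    insert_mem_indepIn hv hF fun u hu => h u ((mem_indepIn.1 hF).1 hu)

open Classical in
lemma exactAt_indepIn_of_vertex {W : Finset (Fin n)} {v : Fin n} (hv : v ∈ W) {m : ℕ}
    (hdel : ExactAt K (indepIn H φ (W.erase v)) m)
    (hlink : ∀ k, m = k + 1 →
      ExactAt K (indepIn H φ ((W.erase v).filter fun u => ¬ H.Adj (φ v) (φ u))) k) :
    ExactAt K (indepIn H φ W) m := by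
  refine exactAt_of_deletion_link v (D := indepIn H φ (W.erase v))
    (L := indepIn H φ ((W.erase v).filter fun u => ¬ H.Adj (φ v) (φ u)))
    ?_ ?_ ?_ ?_ ?_ ?_ hdel hlink
  · intro F hF
    rw [mem_indepIn] at hF ⊢
    exact ⟨hF.1.trans (Finset.erase_subset _ _), hF.2⟩
  · intro F hF hvF
    rw [mem_indepIn] at hF ⊢
    exact ⟨fun u hu => Finset.mem_erase.2 ⟨fun h => hvF (h ▸ hu), hF.1 hu⟩, hF.2⟩
  · intro F hvF hF
    rw [mem_indepIn] at hF ⊢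
    refine ⟨fun u hu => ?_, fun u hu w hw =>
      hF.2 u (Finset.mem_insert_of_mem hu) w (Finset.mem_insert_of_mem hw)⟩
    rw [Finset.mem_filter, Finset.mem_erase]
    exact ⟨⟨fun h => hvF (h ▸ hu), hF.1 (Finset.mem_insert_of_mem hu)⟩,
      hF.2 v (Finset.mem_insert_self _ _) u (Finset.mem_insert_of_mem hu)⟩
  · intro F hF
    rw [mem_indepIn] at hF ⊢
    exact ⟨hF.1.trans (Finset.filter_subset _ _), hF.2⟩
  · intro F hF hvF
    simpa using (mem_indepIn.1 hF).1 hvF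
  · intro F hF
    rw [mem_indepIn] at hF
    refine insert_mem_indepIn hv (mem_indepIn.2 ⟨fun u hu => ?_, hF.2⟩) fun u hu =>
      (Finset.mem_filter.1 (hF.1 hu)).2
    exact Finset.mem_of_mem_erase (Finset.mem_filter.1 (hF.1 hu)).1

/-- Every vertex set `W` mapped into `R` whose independence complex has nonzero reduced homology
in degree `m - 1` satisfies `|W| ≤ p + m`. -/
def HomologyBound (K : Type*) [Field K] (H : SimpleGraph U) (φ : Fin n → U) (R : Set U)
    (p : ℕ) : Prop :=
  ∀ (W : Finset (Fin n)) (m : ℕ), (∀ i ∈ W, φ i ∈ R) → ¬ ExactAt K (indepIn H φ W) m →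
    W.card ≤ p + m

lemma HomologyBound.mono {R S : Set U} {p q : ℕ} (h : HomologyBound K H φ S p) (hRS : R ⊆ S)
    (hpq : p ≤ q) : HomologyBound K H φ R q := fun W m hW hex =>
  (h W m (fun i hi => hRS (hW i hi)) hex).trans (by omega)

/-- Isolated vertices may be discarded. -/
lemma HomologyBound.of_nonisolated {R : Set U} {p : ℕ}
    (h : HomologyBound K H φ {x ∈ R | ∃ y ∈ R, H.Adj x y} p) : HomologyBound K H φ R p := by
  intro W m hW hex
  refine h W m (fun i hi => ⟨hW i hi, ?_⟩) hex
  by_contra! hc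
  exact hex (exactAt_indepIn_of_isolated hi (fun u hu => hc _ (hW u hu)) m)

lemma homologyBound_of_isEmpty {R : Set U} {p : ℕ} (h : ∀ x, x ∉ R) :
    HomologyBound K H φ R p := by
  intro W m hW _
  rw [Finset.eq_empty_of_forall_notMem fun i hi => h _ (hW i hi)]
  simp

open Classical in
/-- The deletion–neighbourhood recursion for the bound. -/
lemma HomologyBound.of_vertex (hφ : Function.Injective φ) {R : Set U} {p q : ℕ} (v : U)
    (T : Finset U) (hdel : HomologyBound K H φ {x ∈ R | x ≠ v} p)
    (hlink : HomologyBound K H φ {x ∈ R | x ≠ v ∧ ¬ H.Adj v x} q)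
    (hT : ∀ x ∈ R, H.Adj v x → x ∈ T) (hq : T.card + q ≤ p + 1) :
    HomologyBound K H φ R (p + 1) := by
  intro W m hW hex
  by_cases hv : ∃ i ∈ W, φ i = v
  · obtain ⟨i, hi, rfl⟩ := hv
    have hne : ∀ u ∈ W.erase i, φ u ≠ φ i := fun u hu h =>
      Finset.ne_of_mem_erase hu (hφ h)
    have hcard : (W.erase i).card + 1 = W.card := Finset.card_erase_add_one hi
    by_cases hd : ExactAt K (indepIn H φ (W.erase i)) m
    · obtain ⟨k, rfl, hk⟩ : ∃ k, m = k + 1 ∧ ¬ ExactAt K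
          (indepIn H φ ((W.erase i).filter fun u => ¬ H.Adj (φ i) (φ u))) k := by
        by_contra! hc
        exact hex (exactAt_indepIn_of_vertex hi hd hc)
      have h1 := hlink _ k (fun u hu => by
        rw [Finset.mem_filter] at hu
        exact ⟨hW u (Finset.mem_of_mem_erase hu.1), hne u hu.1, hu.2⟩) hk
      have h2 : ((W.erase i).filter fun u => H.Adj (φ i) (φ u)).card ≤ T.card :=
        Finset.card_le_card_of_injOn φ (fun u hu => by
          have hu' := Finset.mem_filter.1 hu
          exact hT _ (hW u (Finset.mem_of_mem_erase hu'.1)) hu'.2) hφ.injOn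
      have h3 := Finset.card_filter_add_card_filter_not (s := W.erase i)
        (fun u => H.Adj (φ i) (φ u))
      omega
    · have := hdel _ m (fun u hu => ⟨hW u (Finset.mem_of_mem_erase hu), hne u hu⟩) hd
      omega
  · push Not at hv
    have := hdel W m (fun i hi => ⟨hW i hi, hv i hi⟩) hex
    omega

end Independence

section Ladder

/-- The one-sided infinite ladder without its first rung. -/
def infiniteLadder : SimpleGraph (Bool × ℕ) :=
  SimpleGraph.fromRel fun x y =>
    (x.1 = y.1 ∧ y.2 = x.2 + 1) ∨ (x.2 = y.2 ∧ 1 ≤ x.2 ∧ x.1 ≠ y.1)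

lemma infiniteLadder_adj {x y : Bool × ℕ} :
    infiniteLadder.Adj x y ↔ (x.1 = y.1 ∧ (y.2 = x.2 + 1 ∨ x.2 = y.2 + 1)) ∨
      (x.2 = y.2 ∧ 1 ≤ x.2 ∧ x.1 ≠ y.1) := by
  obtain ⟨a, i⟩ := x
  obtain ⟨b, j⟩ := y
  simp only [infiniteLadder, SimpleGraph.fromRel_adj, ne_eq, Prod.mk.injEq]
  grind

variable {K : Type*} [Field K] {n : ℕ} {φ : Fin n → Bool × ℕ}

lemma homologyBound_ladder (hφ : Function.Injective φ) (k : ℕ) :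
    ∀ (s : ℕ) (R : Set (Bool × ℕ)), (∀ x ∈ R, s ≤ x.2 ∧ x.2 < s + k) →
      (∀ x ∈ R, ∀ y ∈ R, x.2 = s → y.2 = s → ¬ infiniteLadder.Adj x y) →
      HomologyBound K infiniteLadder φ R (3 * k / 2 - 1) := by
  induction k using Nat.strong_induction_on with
  | _ k ih =>
  intro s R hR hs
  rcases Nat.lt_or_ge k 2 with hk | hk
  · refine HomologyBound.of_nonisolated (homologyBound_of_isEmpty ?_)
    rintro x ⟨hx, y, hy, hxy⟩
    have h1 := hR x hx
    have h2 := hR y hy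
    exact hs x hx y hy (by omega) (by omega) hxy
  obtain ⟨l, rfl⟩ : ∃ l, k = l + 2 := ⟨k - 2, by omega⟩
  have ih2 := ih l (by omega) (s + 2)
  have hp : 3 * (l + 2) / 2 - 1 = (3 * l / 2 + 1) + 1 := by omega
  rw [hp]
  refine HomologyBound.of_vertex hφ (q := 3 * l / 2 - 1) (true, s + 1)
    (if l = 0 then {(true, s), (false, s + 1)}
      else {(true, s), (false, s + 1), (true, s + 2)}) ?_ ?_ ?_ ?_
  · refine HomologyBound.of_vertex hφ (q := 3 * l / 2 - 1) (false, s + 1)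
      (if l = 0 then {(false, s)} else {(false, s), (false, s + 2)}) ?_ ?_ ?_ ?_
    · refine HomologyBound.of_nonisolated ?_
      have hR' : ∀ x ∈ {x ∈ {x ∈ {x ∈ R | x ≠ (true, s + 1)} | x ≠ (false, s + 1)} |
          ∃ y ∈ {x ∈ {x ∈ R | x ≠ (true, s + 1)} | x ≠ (false, s + 1)},
            infiniteLadder.Adj x y}, s + 2 ≤ x.2 ∧ x.2 < s + 2 + l := by
        rintro ⟨c, i⟩ ⟨⟨⟨hx, hxa⟩, hxb⟩, ⟨d, j⟩, ⟨⟨hy, hya⟩, hyb⟩, hxy⟩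
        have h1 := hR _ hx
        have h2 := hR _ hy
        have h3 := hs _ hx _ hy
        rw [infiniteLadder_adj] at hxy h3
        clear hR hs ih ih2
        cases c <;> cases d <;> simp at * <;> omega
      rcases Nat.eq_zero_or_pos l with rfl | hl
      · exact homologyBound_of_isEmpty fun x hx => by
          have := hR' x hx
          omega
      obtain ⟨r, rfl⟩ : ∃ r, l = r + 1 := ⟨l - 1, by omega⟩
      have hp' : 3 * (r + 1) / 2 = (3 * (r + 1) / 2 - 1) + 1 := by omega
      rw [hp']
      generalize {x ∈ {x ∈ {x ∈ R | x ≠ (true, s + 1)} | x ≠ (false, s + 1)} |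
          ∃ y ∈ {x ∈ {x ∈ R | x ≠ (true, s + 1)} | x ≠ (false, s + 1)},
            infiniteLadder.Adj x y} = S at hR' ⊢
      refine HomologyBound.of_vertex hφ (q := 3 * r / 2 - 1) (true, s + 2)
        (if r = 0 then {(false, s + 2)} else {(false, s + 2), (true, s + 3)}) ?_ ?_ ?_ ?_
      · refine ih2 _ (fun x hx => hR' x hx.1) ?_
        rintro ⟨c, i⟩ ⟨hx, hxa⟩ ⟨d, j⟩ ⟨hy, hya⟩ hi hj
        rw [infiniteLadder_adj]
        clear hR hs ih ih2
        cases c <;> cases d <;> simp at * <;> omega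
      · refine ih r (by omega) (s + 3) _ ?_ ?_
        · rintro ⟨c, i⟩ ⟨hx, hxa, hn⟩
          have h1 := hR' _ hx
          rw [infiniteLadder_adj] at hn
          clear hR hs ih ih2
          cases c <;> simp at * <;> omega
        · rintro ⟨c, i⟩ ⟨hx, hxa, hxn⟩ ⟨d, j⟩ ⟨hy, hya, hyn⟩ hi hj
          rw [infiniteLadder_adj] at *
          clear hR hs ih ih2
          cases c <;> cases d <;> simp at * <;> omega
      · rintro ⟨c, i⟩ hx hn
        have h1 := hR' _ hx
        rw [infiniteLadder_adj] at hn
        clear hR hs ih ih2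
        split_ifs <;> cases c <;> simp at * <;> omega
      · split_ifs
        · subst r
          simp
        · rw [Finset.card_pair (by simp)]
          omega
    · refine HomologyBound.of_nonisolated (ih2 _ ?_ ?_)
      · rintro ⟨c, i⟩ ⟨⟨⟨hx, hxa⟩, hxb, hxn⟩, ⟨d, j⟩, ⟨⟨hy, hya⟩, hyb, hyn⟩, hxy⟩
        have h1 := hR _ hx
        have h2 := hR _ hy
        have h3 := hs _ hx _ hy
        rw [infiniteLadder_adj] at *
        clear hR hs ih ih2
        cases c <;> cases d <;> simp at * <;> omega
      · rintro ⟨c, i⟩ ⟨⟨⟨hx, hxa⟩, hxb, hxn⟩, -⟩ ⟨d, j⟩ ⟨⟨⟨hy, hya⟩, hyb, hyn⟩, -⟩ hi hj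
        rw [infiniteLadder_adj] at *
        clear hR hs ih ih2
        cases c <;> cases d <;> simp at * <;> omega
    · rintro ⟨c, i⟩ ⟨hx, hxa⟩ hn
      have h1 := hR _ hx
      rw [infiniteLadder_adj] at hn
      clear hR hs ih ih2
      split_ifs <;> cases c <;> simp at * <;> omega
    · split_ifs
      · subst l
        simp
      · rw [Finset.card_pair (by simp)]
        omega
  · refine HomologyBound.of_nonisolated (ih2 _ ?_ ?_)
    · rintro ⟨c, i⟩ ⟨⟨hx, hxa, hxn⟩, ⟨d, j⟩, ⟨hy, hya, hyn⟩, hxy⟩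
      have h1 := hR _ hx
      have h2 := hR _ hy
      have h3 := hs _ hx _ hy
      rw [infiniteLadder_adj] at *
      clear hR hs ih ih2
      cases c <;> cases d <;> simp at * <;> omega
    · rintro ⟨c, i⟩ ⟨⟨hx, hxa, hxn⟩, -⟩ ⟨d, j⟩ ⟨⟨hy, hya, hyn⟩, -⟩ hi hj
      rw [infiniteLadder_adj] at *
      clear hR hs ih ih2
      cases c <;> cases d <;> simp at * <;> omega
  · rintro ⟨c, i⟩ hx hn
    have h1 := hR _ hx
    rw [infiniteLadder_adj] at hn
    clear hR hs ih ih2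
    split_ifs <;> cases c <;> simp at * <;> omega
  · split_ifs
    · subst l
      rw [Finset.card_pair (by simp)]
    · rw [Finset.card_eq_three.2 ⟨_, _, _, by simp, by simp, by simp, rfl⟩]
      omega

end Ladder

/-- If the independence complexes of all induced subgraphs satisfy the homology bound `p + 1`,
then the projective dimension of the edge ideal is at most `p`. -/
lemma pdEdgeIdeal_le_of_homologyBound (K : Type*) [Field K] {V U : Type*} [Fintype V]
    {G : SimpleGraph V} {H : SimpleGraph U} (f : V → U)
    (hf : ∀ x y, G.Adj x y ↔ H.Adj (f x) (f y)) {p : ℕ}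
    (hb : HomologyBound K H (fun i => f ((Fintype.equivFin V).symm i)) (Set.range f) (p + 1)) :
    pdEdgeIdeal K G ≤ p := by
  refine csSup_le' ?_
  rintro i ⟨j, hj⟩
  obtain ⟨W, hW, hne⟩ := Finset.exists_ne_zero_of_sum_ne_zero hj
  have hcard := (Finset.mem_powersetCard.1 hW).2
  have hind : (indComplex G).filter (fun F => F ⊆ W) =
      indepIn H (fun i => f ((Fintype.equivFin V).symm i)) W := by
    ext F
    simp [indComplex, mem_indepIn, hf, and_comm]
  rw [hind] at hne
  by_cases hij : i + 1 ≤ j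
  · obtain ⟨m, rfl⟩ : ∃ m, j = i + 1 + m := ⟨j - (i + 1), by omega⟩
    have hm : ((i + 1 + m : ℕ) : ℤ) - i - 2 = m - 1 := by push_cast; ring
    rw [hm] at hne
    have := hb W m (fun i _ => ⟨_, rfl⟩) fun hex => hne (reducedHomologyRank_eq_zero
      (fun F hF G hG => by
        rw [mem_indepIn] at hF ⊢
        exact ⟨hG.trans hF.1, fun u hu v hv => hF.2 u (hG hu) v (hG hv)⟩) hex)
    omega
  · refine absurd ?_ hne
    rw [reducedHomologyRank, if_neg (by omega), if_neg (by omega)]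

lemma pdEdgeIdeal_graphA_le (K : Type*) [Field K] (t : ℕ) :
    pdEdgeIdeal K (graphA t) ≤ 3 * t / 2 + 1 := by
  have hinj : Function.Injective fun x : Bool × Fin (t + 2) => (x.1, (x.2 : ℕ)) := by
    rintro ⟨a, i⟩ ⟨b, j⟩ h
    simpa [Fin.ext_iff] using h
  refine pdEdgeIdeal_le_of_homologyBound K (H := infiniteLadder)
    (fun x => (x.1, (x.2 : ℕ))) ?_ ?_
  · rintro ⟨a, i⟩ ⟨b, j⟩
    simp [graphA, infiniteLadder, SimpleGraph.fromRel_adj, Fin.ext_iff]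
  · refine (homologyBound_ladder (hinj.comp (Equiv.injective _)) (t + 2) 0 _ ?_ ?_).mono
      subset_rfl (by omega)
    · rintro _ ⟨x, rfl⟩
      exact ⟨Nat.zero_le _, by simp⟩
    · intro x _ y _ hx hy
      rw [infiniteLadder_adj]
      omega

/-- **Lemma 4.2(i), projective-dimension part.**
For `t ≥ 1`, the edge ideal of the graph `A_t` satisfies
`pd(I(A_t)) ≤ 3t/2 + 1` if `t` is even and `pd(I(A_t)) ≤ 3(t-1)/2 + 2` if `t`
is odd. -/
theorem projective_dimension_bound_graphA (K : Type*) [Field K] (t : ℕ) (ht : 1 ≤ t) :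
    (Even t → pdEdgeIdeal K (graphA t) ≤ 3 * t / 2 + 1) ∧
    (Odd t → pdEdgeIdeal K (graphA t) ≤ 3 * (t - 1) / 2 + 2) := by
  have h := pdEdgeIdeal_graphA_le K t
  exact ⟨fun _ => h, fun ⟨k, hk⟩ => h.trans (by omega)⟩
end
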